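/- arXiv:2605.30530 — 8 statements merged into one kernel-verified Lean document; each statement's English description precedes it below -/
import Mathlib

section
/- Let n ≥ 1 be an integer, let A be a finite abelian group, and let f : A × A → ℤ/nℤ be an alternating biadditive pairing with radical R. If G ⊆ A is a subgroup satisfying G = G^⊥, then |G|² = |R| · |A|. -/
/-- The sum of the standard additive character along a homomorphism to `ZMod n`. -/
theorem sum_stdAddChar_addMonoidHom {n : ℕ} [NeZero n] {B : Type*} [AddCommGroup B] [Fintype B]
    (φ : B →+ ZMod n) [Decidable (φ = 0)] :
    ∑ b, ZMod.stdAddChar (φ b) = if φ = 0 then (Fintype.card B : ℂ) else 0 := by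
  classical
  have hzero : ZMod.stdAddChar.compAddMonoidHom φ = 0 ↔ φ = 0 := by
    rw [AddChar.eq_zero_iff, DFunLike.ext_iff]
    refine forall_congr' fun b ↦ ?_
    rw [AddChar.compAddMonoidHom_apply, ← AddChar.map_zero_eq_one (ZMod.stdAddChar (N := n)),
      ZMod.injective_stdAddChar.eq_iff, AddMonoidHom.zero_apply]
  simpa only [AddChar.compAddMonoidHom_apply, hzero] using
    AddChar.sum_eq_ite (ZMod.stdAddChar.compAddMonoidHom φ)

/-- The two kernels of a biadditive pairing of finite abelian groups into `ZMod n` have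
sizes proportional to those of the respective groups. -/
theorem card_ker_mul_card_eq_card_ker_flip_mul_card {n : ℕ} [NeZero n] {B C : Type*}
    [AddCommGroup B] [Finite B] [AddCommGroup C] [Finite C] (φ : B →+ C →+ ZMod n) :
    Nat.card φ.ker * Nat.card C = Nat.card φ.flip.ker * Nat.card B := by
  classical
  have := Fintype.ofFinite B
  have := Fintype.ofFinite C
  have hcomm : ∑ b, ∑ c, ZMod.stdAddChar (φ b c) = ∑ c, ∑ b, ZMod.stdAddChar (φ.flip c b) :=
    Finset.sum_comm
  simp only [sum_stdAddChar_addMonoidHom, ← Finset.sum_filter, Finset.sum_const,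
    nsmul_eq_mul] at hcomm
  simp only [Nat.card_eq_fintype_card, AddMonoidHom.mem_ker, Fintype.card_subtype]
  exact_mod_cast hcomm

/-- For an alternating biadditive pairing `f : A × A → ℤ/nℤ` on a
finite abelian group `A` with radical `R`, any subgroup `G` with `G = G^⊥`
satisfies `|G|² = |R| · |A|`. -/
theorem stmt_0 (n : ℕ) (hn : 1 ≤ n) (A : Type) [AddCommGroup A] [Fintype A]
    (f : A → A → ZMod n)
    (hbil : ∀ x y z : A, f (x + y) z = f x z + f y z)
    (hbir : ∀ x y z : A, f x (y + z) = f x y + f x z)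
    (halt : ∀ x : A, f x x = 0)
    (G : AddSubgroup A)
    (hG : (G : Set A) = {x : A | ∀ g ∈ G, f g x = 0}) :
    Nat.card G ^ 2 = Nat.card {x : A | ∀ y : A, f x y = 0} * Fintype.card A := by
  have : NeZero n := ⟨by omega⟩
  let φ : G →+ A →+ ZMod n :=
    AddMonoidHom.mk' (fun g ↦ AddMonoidHom.mk' (f g) (hbir g))
      fun g h ↦ AddMonoidHom.ext (hbil g h)
  have hskew (x y : A) : f x y = - f y x := by
    have h := halt (x + y)
    rw [hbil, hbir, hbir, halt, halt, zero_add, add_zero] at h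
    exact eq_neg_of_add_eq_zero_left h
  have hmem (x : A) : x ∈ G ↔ ∀ g ∈ G, f g x = 0 := Set.ext_iff.mp hG x
  have hR : Nat.card φ.ker = Nat.card {x : A | ∀ y : A, f x y = 0} :=
    Nat.card_congr
      { toFun := fun g ↦ ⟨g.1, fun y ↦ DFunLike.congr_fun g.2 y⟩
        invFun := fun x ↦ ⟨⟨x, (hmem x).2 fun g _ ↦ by rw [hskew, x.2 g, neg_zero]⟩,
          AddMonoidHom.ext x.2⟩ }
  have hperp : φ.flip.ker = G := by
    ext x
    rw [hmem, AddMonoidHom.mem_ker, DFunLike.ext_iff]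
    exact Subtype.forall
  have hcard := card_ker_mul_card_eq_card_ker_flip_mul_card φ
  rw [hR, hperp, Nat.card_eq_fintype_card (α := A)] at hcard
  rw [hcard, sq]
end

section
/- Let n ≥ 1 be an integer, let A be a finite abelian group, and let f : A × A → ℤ/nℤ be an alternating biadditive pairing which is nondegenerate, i.e. whose radical is trivial. If G ⊆ A is a subgroup satisfying G = G^⊥, then |G|² = |A|. -/
open Classical in
/-- Orthogonality of characters for the composition of an additive map `φ : B → ℤ/nℤ` with the
standard character. -/
lemma sum_stdAddChar_comp {n : ℕ} [NeZero n] {B : Type*} [AddCommGroup B] [Fintype B]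
    (φ : B →+ ZMod n) :
    ∑ b, ZMod.stdAddChar (φ b) = if ∀ b, φ b = 0 then (Fintype.card B : ℂ) else 0 := by
  have h : ZMod.stdAddChar.compAddMonoidHom φ = 0 ↔ ∀ b, φ b = 0 := by
    rw [DFunLike.ext_iff]
    refine forall_congr' fun b => ?_
    rw [AddChar.compAddMonoidHom_apply, AddChar.zero_apply,
      ← AddChar.map_zero_eq_one (ZMod.stdAddChar (N := n)), ZMod.injective_stdAddChar.eq_iff]
  simpa only [AddChar.compAddMonoidHom_apply, h] using
    AddChar.sum_eq_ite (ZMod.stdAddChar.compAddMonoidHom φ)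

/-- For a nondegenerate alternating biadditive pairing
`f : A × A → ℤ/nℤ` on a finite abelian group `A`, any subgroup `G` with
`G = G^⊥` satisfies `|G|² = |A|`. -/
theorem stmt_1 (n : ℕ) (hn : 1 ≤ n) (A : Type) [AddCommGroup A] [Fintype A]
    (f : A → A → ZMod n)
    (hbil : ∀ x y z : A, f (x + y) z = f x z + f y z)
    (hbir : ∀ x y z : A, f x (y + z) = f x y + f x z)
    (halt : ∀ x : A, f x x = 0)
    (hnd : ∀ x : A, (∀ y : A, f x y = 0) → x = 0)
    (G : AddSubgroup A)
    (hG : (G : Set A) = {x : A | ∀ g ∈ G, f g x = 0}) :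
    Nat.card G ^ 2 = Fintype.card A := by
  classical
  have : NeZero n := ⟨by omega⟩
  have hmem (x : A) : x ∈ G ↔ ∀ g : G, f g x = 0 := by
    rw [← SetLike.mem_coe, hG]
    simp
  have sum_left (x : A) : ∑ g : G, (ZMod.stdAddChar (f g x) : ℂ) =
      if x ∈ G then (Fintype.card G : ℂ) else 0 := by
    simpa only [hmem x, AddMonoidHom.mk'_apply] using sum_stdAddChar_comp
      (AddMonoidHom.mk' (fun g : G => f g x) fun a b => hbil a b x)
  have sum_right (g : G) : ∑ x : A, (ZMod.stdAddChar (f g x) : ℂ) =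
      if g = 0 then (Fintype.card A : ℂ) else 0 := by
    have h : (∀ x, f g x = 0) ↔ g = 0 := by
      refine ⟨fun h => Subtype.ext (hnd g h), ?_⟩
      rintro rfl x
      simpa using hbil 0 0 x
    simpa only [← h, AddMonoidHom.mk'_apply] using sum_stdAddChar_comp (AddMonoidHom.mk' (f g) (hbir g))
  have key : ∑ x : A, ∑ g : G, (ZMod.stdAddChar (f g x) : ℂ) =
      ∑ g : G, ∑ x : A, (ZMod.stdAddChar (f g x) : ℂ) := Finset.sum_comm
  simp only [sum_left, sum_right, Finset.sum_ite_eq', Finset.mem_univ, if_true] at key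
  rw [← Finset.sum_filter, Finset.sum_const, ← Fintype.card_subtype, nsmul_eq_mul] at key
  rw [Nat.card_eq_fintype_card, sq]
  exact_mod_cast key
end

section
/- Let n ≥ 1 be an integer, let A be a finite abelian group, and let f : A × A → ℤ/nℤ be an alternating biadditive pairing. Then there exists a subgroup G ⊆ A with G = G^⊥. -/
/-- Adjoining to an isotropic subgroup an element orthogonal to it keeps it isotropic. -/
theorem AddMonoidHom.isotropic_sup_zmultiples {A B : Type*} [AddCommGroup A] [AddCommGroup B]
    (F : A →+ A →+ B) (hF : ∀ x, F x x = 0) {G : AddSubgroup A}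
    (hG : ∀ g ∈ G, ∀ h ∈ G, F g h = 0) {x : A} (hx : ∀ g ∈ G, F g x = 0) :
    ∀ g ∈ G ⊔ AddSubgroup.zmultiples x, ∀ h ∈ G ⊔ AddSubgroup.zmultiples x, F g h = 0 := by
  have hx' : ∀ g ∈ G, F x g = 0 := fun g hg ↦ by
    simpa [hF, hx g hg] using hF (x + g)
  intro g hg h hh
  obtain ⟨a, ha, _, ⟨k, rfl⟩, rfl⟩ := AddSubgroup.mem_sup.1 hg
  obtain ⟨b, hb, _, ⟨l, rfl⟩, rfl⟩ := AddSubgroup.mem_sup.1 hh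
  simp [hF, hG a ha b hb, hx a ha, hx' b hb]

/-- An alternating pairing on a finite abelian group has a subgroup equal to its own
perpendicular subgroup. -/
theorem AddMonoidHom.exists_addSubgroup_eq_perp {A B : Type*} [AddCommGroup A] [Finite A]
    [AddCommGroup B] (F : A →+ A →+ B) (hF : ∀ x, F x x = 0) :
    ∃ G : AddSubgroup A, (G : Set A) = {x : A | ∀ g ∈ G, F g x = 0} := by
  obtain ⟨G, hG⟩ := (Set.toFinite {G : AddSubgroup A | ∀ g ∈ G, ∀ h ∈ G, F g h = 0}).exists_maximal
    ⟨⊥, by simp⟩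
  refine ⟨G, Set.Subset.antisymm (fun x hx g hg ↦ hG.prop g hg x hx) fun x hx ↦ ?_⟩
  exact hG.le_of_ge (F.isotropic_sup_zmultiples hF hG.prop hx) le_sup_left
    (AddSubgroup.mem_sup_right (AddSubgroup.mem_zmultiples x))

/-- For an alternating biadditive pairing `f : A × A → ℤ/nℤ` on
a finite abelian group `A`, there exists a subgroup `G` with `G = G^⊥`
(a maximal isotropic subgroup). -/
theorem stmt_2 (n : ℕ) (hn : 1 ≤ n) (A : Type) [AddCommGroup A] [Fintype A]
    (f : A → A → ZMod n)
    (hbil : ∀ x y z : A, f (x + y) z = f x z + f y z)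
    (hbir : ∀ x y z : A, f x (y + z) = f x y + f x z)
    (halt : ∀ x : A, f x x = 0) :
    ∃ G : AddSubgroup A, (G : Set A) = {x : A | ∀ g ∈ G, f g x = 0} :=
  AddMonoidHom.exists_addSubgroup_eq_perp
    (AddMonoidHom.mk' (fun x ↦ AddMonoidHom.mk' (f x) (hbir x))
      fun x y ↦ AddMonoidHom.ext (hbil x y)) halt
end

section
/- Let t ≥ 1, n ≥ 1, k ≥ 0 be integers and let N be a k × k matrix with integer entries. Then the image of the reduction of the matrix t·N modulo tn has the same cardinality as the image of the reduction of N modulo n; that is, |im((t·N) mod tn)| = |im(N mod n)|. -/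
open Matrix

/-- Functions on the same domain with the same fibres have ranges of the same cardinality. -/
theorem natCard_range_eq_of_forall_eq_iff {α β γ : Type*} {f : α → β} {g : α → γ}
    (h : ∀ x y, f x = f y ↔ g x = g y) : Nat.card (Set.range f) = Nat.card (Set.range g) :=
  Nat.card_congr <| (Setoid.quotientKerEquivRange f).symm.trans <|
    (Quotient.congr (Equiv.refl α) h).trans (Setoid.quotientKerEquivRange g)

/-- The image of an integer matrix reduced mod `m` is the set of reductions of its integral
image. -/
theorem coe_range_mulVecLin_map_intCast {ι κ : Type*} [Fintype κ] (m : ℕ)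
    (M : Matrix ι κ ℤ) :
    (LinearMap.range (M.map (Int.cast : ℤ → ZMod m)).mulVecLin : Set (ι → ZMod m)) =
      Set.range fun (x : κ → ℤ) (i : ι) => ((M *ᵥ x) i : ZMod m) := by
  have key : ∀ x : κ → ℤ, (M.map (Int.cast : ℤ → ZMod m)) *ᵥ (fun j => (x j : ZMod m)) =
      fun i => ((M *ᵥ x) i : ZMod m) := fun x =>
    funext fun i => ((Int.castRingHom (ZMod m)).map_mulVec M x i).symm
  ext v
  constructor
  · rintro ⟨w, rfl⟩
    choose x hx using fun j => ZMod.intCast_surjective (w j)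
    obtain rfl : (fun j => (x j : ZMod m)) = w := funext hx
    exact ⟨x, (key x).symm⟩
  · rintro ⟨x, rfl⟩
    exact ⟨fun j => (x j : ZMod m), key x⟩

theorem natCard_range_mulVecLin_map_intCast {ι κ : Type*} [Fintype κ] (m : ℕ)
    (M : Matrix ι κ ℤ) :
    Nat.card (LinearMap.range (M.map (Int.cast : ℤ → ZMod m)).mulVecLin) =
      Nat.card (Set.range fun (x : κ → ℤ) (i : ι) => ((M *ᵥ x) i : ZMod m)) :=
  Nat.card_congr (Equiv.setCongr (coe_range_mulVecLin_map_intCast m M))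

/-- For a `k × k` integer matrix `N` and positive integers `t, n`,
the image of `t·N` reduced mod `t·n` has the same cardinality as the image of `N`
reduced mod `n`. -/
theorem stmt_5 (t n : ℕ) (ht : 1 ≤ t) (hn : 1 ≤ n) (k : ℕ)
    (N : Matrix (Fin k) (Fin k) ℤ) :
    Nat.card (LinearMap.range ((((t : ℤ) • N).map
        (Int.cast : ℤ → ZMod (t * n))).mulVecLin)) =
    Nat.card (LinearMap.range ((N.map (Int.cast : ℤ → ZMod n)).mulVecLin)) := by
  have ht' : (t : ℤ) ≠ 0 := by exact_mod_cast Nat.one_le_iff_ne_zero.mp ht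
  rw [natCard_range_mulVecLin_map_intCast, natCard_range_mulVecLin_map_intCast]
  refine natCard_range_eq_of_forall_eq_iff fun x y => ?_
  simp only [funext_iff]
  refine forall_congr' fun i => ?_
  rw [ZMod.intCast_eq_intCast_iff_dvd_sub, ZMod.intCast_eq_intCast_iff_dvd_sub, smul_mulVec,
    smul_mulVec, Pi.smul_apply, Pi.smul_apply, smul_eq_mul, smul_eq_mul, ← mul_sub, Nat.cast_mul,
    mul_dvd_mul_iff_left ht']
end

section
/- Let t ≥ 1, n ≥ 1 be integers, let M, H₁, …, H_k be 2g × 2g integer matrices. Then for every b = (b₁, …, b_k) ∈ ℤ^k there exists a = (a₁, …, a_k) ∈ ℤ^k such that |im((t·M + Σᵢ aᵢ·Hᵢ) mod tn)| ≤ |im((M + Σᵢ bᵢ·Hᵢ) mod n)|. -/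
open Matrix

/-- Multiplying an integer by `t` modulo `t * n` depends only on its class modulo `n`. -/
theorem ZMod.natCast_mul_cast_intCast (t n : ℕ) (z : ℤ) :
    (t : ZMod (t * n)) * (((z : ZMod n).cast : ℤ) : ZMod (t * n)) = ((t * z : ℤ) : ZMod (t * n)) := by
  have h : (n : ℤ) ∣ z - ((z : ZMod n).cast : ℤ) := by
    rw [← ZMod.intCast_eq_intCast_iff_dvd_sub, ZMod.intCast_cast, ZMod.cast_id]
  have h' : ((t * n : ℕ) : ℤ) ∣ t * z - t * ((z : ZMod n).cast : ℤ) := by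
    rw [← mul_sub, Nat.cast_mul]
    exact mul_dvd_mul_left _ h
  rw [← ZMod.intCast_eq_intCast_iff_dvd_sub] at h'
  rw [← h']
  push_cast
  rfl

theorem Matrix.map_intCast_mulVec {ι : Type*} [Fintype ι] {R : Type*} [CommRing R]
    (N : Matrix ι ι ℤ) (v : ι → ℤ) :
    (N.map (Int.cast : ℤ → R)) *ᵥ (fun i => (v i : R)) = fun i => ((N *ᵥ v) i : R) := by
  ext i
  simp [Matrix.mulVec, dotProduct]

/-- Scaling an integer matrix by `t` and the modulus from `n` to `t * n` does not enlarge the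
image. -/
theorem Matrix.card_range_smul_map_intCast_le {ι : Type*} [Fintype ι] (t n : ℕ) [NeZero n]
    (N : Matrix ι ι ℤ) :
    Nat.card (LinearMap.range ((((t : ℤ) • N).map
        (Int.cast : ℤ → ZMod (t * n))).mulVecLin)) ≤
      Nat.card (LinearMap.range ((N.map (Int.cast : ℤ → ZMod n)).mulVecLin)) := by
  let f : (ι → ZMod n) → (ι → ZMod (t * n)) := fun y i => t * (((y i).cast : ℤ) : ZMod (t * n))
  let S : Set (ι → ZMod n) := LinearMap.range ((N.map (Int.cast : ℤ → ZMod n)).mulVecLin)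
  have hsub : ((LinearMap.range ((((t : ℤ) • N).map
      (Int.cast : ℤ → ZMod (t * n))).mulVecLin) : Submodule _ _) : Set (ι → ZMod (t * n))) ⊆
      f '' S := by
    rintro _ ⟨x, rfl⟩
    choose v hv using fun i => ZMod.intCast_surjective (x i)
    obtain rfl : (fun i => (v i : ZMod (t * n))) = x := funext hv
    refine ⟨_, ⟨fun i => (v i : ZMod n), rfl⟩, ?_⟩
    ext i
    simp only [f, Matrix.mulVecLin_apply, Matrix.map_intCast_mulVec,
      ZMod.natCast_mul_cast_intCast, Matrix.smul_mulVec, Pi.smul_apply, smul_eq_mul]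
  have hS : S.Finite := Set.toFinite S
  exact (Set.ncard_le_ncard hsub (hS.image f)).trans (Set.ncard_image_le hS)

/-- Matrix form of `Ann_{tn}(α) ≤ Ann_n(α)`: for `2g × 2g` integer
matrices `M, H₁, …, H_k` and every `b ∈ ℤ^k` there is `a ∈ ℤ^k` with
`|im((t·M + Σ aᵢHᵢ) mod tn)| ≤ |im((M + Σ bᵢHᵢ) mod n)|`. -/
theorem stmt_6 (t n : ℕ) (ht : 1 ≤ t) (hn : 1 ≤ n) (g k : ℕ)
    (M : Matrix (Fin (2 * g)) (Fin (2 * g)) ℤ)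
    (H : Fin k → Matrix (Fin (2 * g)) (Fin (2 * g)) ℤ)
    (b : Fin k → ℤ) :
    ∃ a : Fin k → ℤ,
      Nat.card (LinearMap.range ((((t : ℤ) • M + ∑ i, a i • H i).map
          (Int.cast : ℤ → ZMod (t * n))).mulVecLin)) ≤
      Nat.card (LinearMap.range (((M + ∑ i, b i • H i).map
          (Int.cast : ℤ → ZMod n)).mulVecLin)) := by
  have : NeZero n := ⟨by omega⟩
  refine ⟨fun i => t * b i, ?_⟩
  have h : (t : ℤ) • M + ∑ i, (t * b i) • H i = (t : ℤ) • (M + ∑ i, b i • H i) := by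
    simp only [smul_add, Finset.smul_sum, mul_smul]
  rw [h]
  exact Matrix.card_range_smul_map_intCast_le t n _
end

section
/- Let t ≥ 1, n ≥ 1 be integers with gcd(t, n) = 1, and let M, H₁, …, H_k be 2g × 2g integer matrices. Then for every a = (a₁, …, a_k) ∈ ℤ^k there exists b = (b₁, …, b_k) ∈ ℤ^k such that |im((M + Σᵢ bᵢ·Hᵢ) mod n)| ≤ |im((t·M + Σᵢ aᵢ·Hᵢ) mod tn)|. -/
open Matrix

/-- If `B = s • A.map f` for a surjective ring homomorphism `f : R →+* S` from a finite ring, then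
the range of `B` has at most as many elements as the range of `A`. -/
theorem Matrix.card_range_mulVecLin_le_of_eq_smul_map {R S ι κ : Type*} [CommRing R] [CommRing S]
    [Finite R] [Finite ι] [Fintype κ] (f : R →+* S) (hf : Function.Surjective f)
    (A : Matrix ι κ R) (B : Matrix ι κ S) (s : S) (h : B = s • A.map f) :
    Nat.card (LinearMap.range B.mulVecLin) ≤ Nat.card (LinearMap.range A.mulVecLin) := by
  have hsub : (LinearMap.range B.mulVecLin : Set (ι → S)) ⊆
      (fun y : ι → R => s • (f ∘ y)) '' (LinearMap.range A.mulVecLin : Set (ι → R)) := by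
    rintro _ ⟨x, rfl⟩
    obtain ⟨x, rfl⟩ := hf.comp_left x
    refine ⟨A *ᵥ x, ⟨x, rfl⟩, ?_⟩
    ext i
    simp [h, RingHom.map_mulVec]
  exact (Set.ncard_le_ncard hsub (Set.toFinite _)).trans (Set.ncard_image_le (Set.toFinite _))

/-- Matrix form of `Ann_n(α) ≤ Ann_{tn}(α)` for `gcd(t,n) = 1`:
for `2g × 2g` integer matrices `M, H₁, …, H_k` and every `a ∈ ℤ^k` there is
`b ∈ ℤ^k` with `|im((M + Σ bᵢHᵢ) mod n)| ≤ |im((t·M + Σ aᵢHᵢ) mod tn)|`. -/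
theorem stmt_8 (t n : ℕ) (ht : 1 ≤ t) (hn : 1 ≤ n) (hcop : Nat.Coprime t n) (g k : ℕ)
    (M : Matrix (Fin (2 * g)) (Fin (2 * g)) ℤ)
    (H : Fin k → Matrix (Fin (2 * g)) (Fin (2 * g)) ℤ)
    (a : Fin k → ℤ) :
    ∃ b : Fin k → ℤ,
      Nat.card (LinearMap.range (((M + ∑ i, b i • H i).map
          (Int.cast : ℤ → ZMod n)).mulVecLin)) ≤
      Nat.card (LinearMap.range ((((t : ℤ) • M + ∑ i, a i • H i).map
          (Int.cast : ℤ → ZMod (t * n))).mulVecLin)) := by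
  have : NeZero (t * n) := ⟨by positivity⟩
  obtain ⟨s, hs⟩ : ∃ s : ℤ, (s : ZMod n) * (t : ZMod n) = 1 := by
    obtain ⟨s, hs⟩ := ZMod.intCast_surjective ((t : ZMod n)⁻¹)
    exact ⟨s, by rw [hs, mul_comm, ZMod.coe_mul_inv_eq_one t hcop]⟩
  refine ⟨fun i => s * a i, Matrix.card_range_mulVecLin_le_of_eq_smul_map
    (ZMod.castHom (dvd_mul_left n t) (ZMod n)) (ZMod.castHom_surjective _) _ _ (s : ZMod n) ?_⟩
  ext i j
  simp only [Matrix.map_apply, Matrix.add_apply, Matrix.smul_apply, Matrix.sum_apply, smul_eq_mul,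
    map_intCast]
  push_cast
  rw [mul_add, ← mul_assoc, hs, one_mul, Finset.mul_sum]
  simp only [mul_assoc]
end

section
/- Let n ≥ 1 and g ≥ 1 be integers and let d₁, …, d_g be integers. If n divides the product d₁ ⋯ d_g, then Π_{i=1}^{g} (n/gcd(dᵢ, n)) divides n^{g−1}. -/
theorem gcd_finset_prod_dvd_prod_gcd {ι : Type*} (s : Finset ι) (f : ι → ℕ) (n : ℕ) :
    n.gcd (∏ i ∈ s, f i) ∣ ∏ i ∈ s, n.gcd (f i) := by
  classical
  induction s using Finset.induction_on with
  | empty => simp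
  | insert a s ha ih =>
    rw [Finset.prod_insert ha, Finset.prod_insert ha]
    exact (Nat.gcd_mul_right_dvd_mul_gcd n _ _).trans (mul_dvd_mul_left _ ih)

/-- If `n` divides the product `d₁ ⋯ d_g` of integers, then
`Πᵢ (n / gcd(dᵢ, n))` divides `n^{g-1}`. -/
theorem stmt_12 (n g : ℕ) (hn : 1 ≤ n) (hg : 1 ≤ g) (d : Fin g → ℤ)
    (hdvd : (n : ℤ) ∣ ∏ i, d i) :
    (∏ i, n / Int.gcd (d i) n) ∣ n ^ (g - 1) := by
  have habs : n ∣ ∏ i, (d i).natAbs := by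
    have h := Int.natCast_dvd.mp hdvd
    rwa [← Int.natAbsHom_apply, map_prod] at h
  have hgcd : n ∣ ∏ i, Int.gcd (d i) n := by
    have h := gcd_finset_prod_dvd_prod_gcd Finset.univ (fun i => (d i).natAbs) n
    rw [Nat.gcd_eq_left habs] at h
    simpa only [Int.gcd_def, Int.natAbs_natCast, Nat.gcd_comm] using h
  have hprod : (∏ i, n / Int.gcd (d i) n) * ∏ i, Int.gcd (d i) n = n ^ (g - 1) * n := by
    have hdiv (i : Fin g) : Int.gcd (d i) n ∣ n := by
      simpa using Int.gcd_dvd_natAbs_right (d i) n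
    rw [← Finset.prod_mul_distrib, ← pow_succ, Nat.sub_add_cancel hg]
    simp [Nat.div_mul_cancel (hdiv _)]
  exact Nat.dvd_of_mul_dvd_mul_right hn (hprod ▸ mul_dvd_mul_left _ hgcd)
end

section
/- Let g ≥ 1 and n ≥ 1 be integers and let M be an alternating 2g × 2g integer matrix (Mᵀ = −M). If n² divides det(M), then |im(M mod n)| divides n^{2(g−1)}. -/
open Matrix

/-- A nonzero integral bilinear form has a nonzero value dividing all values sharing
one of its arguments. -/
theorem exists_bilin_value_dvd {V : Type*} [AddCommGroup V] (B : V →ₗ[ℤ] V →ₗ[ℤ] ℤ)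
    (hB : B ≠ 0) :
    ∃ x y, B x y ≠ 0 ∧ (∀ z, B x y ∣ B x z) ∧ ∀ z, B x y ∣ B z y := by
  have hex : ∃ k : ℕ, ∃ x y, B x y ≠ 0 ∧ (B x y).natAbs = k := by
    by_contra! h
    exact hB (LinearMap.ext₂ fun x y => by_contra fun hxy => h _ x y hxy rfl)
  classical
  obtain ⟨x, y, hxy, hk⟩ := Nat.find_spec hex
  have hmin : ∀ u v, (B u v).natAbs < (B x y).natAbs → B u v = 0 := fun u v h => by
    by_contra hne
    exact Nat.find_min hex (hk ▸ h) ⟨u, v, hne, rfl⟩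
  have hlt : ∀ a : ℤ, (a % B x y).natAbs < (B x y).natAbs := fun a => by
    have h₁ := Int.emod_nonneg a hxy
    have h₂ := Int.emod_lt_abs a hxy
    rw [Int.abs_eq_natAbs] at h₂
    omega
  refine ⟨x, y, hxy, fun z => ?_, fun z => ?_⟩
  · have h : B x (z - (B x z / B x y) • y) = B x z % B x y := by
      rw [map_sub, map_smul, smul_eq_mul, Int.emod_def, mul_comm]
    exact Int.dvd_of_emod_eq_zero (h ▸ hmin _ _ (h ▸ hlt _))
  · have h : B (z - (B z y / B x y) • x) y = B z y % B x y := by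
      rw [map_sub, map_smul, LinearMap.sub_apply, LinearMap.smul_apply, smul_eq_mul,
        Int.emod_def, mul_comm]
    exact Int.dvd_of_emod_eq_zero (h ▸ hmin _ _ (h ▸ hlt _))

/-- The alternating `2 × 2` matrix with upper right entry `d`. -/
def alternatingBlock {R : Type*} [Ring R] (d : R) : Matrix (Fin 2) (Fin 2) R :=
  !![0, d; -d, 0]

/-- The span of a hyperbolic pair whose value divides all values of the form on it is
complemented by its orthogonal. -/
theorem isCompl_span_pair_orthogonal {V : Type*} [AddCommGroup V] (B : V →ₗ[ℤ] V →ₗ[ℤ] ℤ)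
    (hB : B.IsAlt) {x y : V} (hxy : B x y ≠ 0) (hx : ∀ z, B x y ∣ B x z)
    (hy : ∀ z, B x y ∣ B z y) :
    IsCompl (Submodule.span ℤ (Set.range ![x, y])) (LinearMap.ker (B x) ⊓ LinearMap.ker (B y)) := by
  have hyx : B y x = -B x y := (hB.neg x y).symm
  have hspan : Set.range ![x, y] = {x, y} := by simp [Matrix.range_cons, Set.pair_comm]
  rw [hspan]
  constructor
  · rw [Submodule.disjoint_def]
    rintro z hz ⟨h₁, h₂⟩
    obtain ⟨a, b, rfl⟩ := Submodule.mem_span_pair.1 hz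
    simp only [SetLike.mem_coe, LinearMap.mem_ker, map_add, map_smul, hB x, hB y, hyx,
      smul_eq_mul, mul_zero, zero_add, add_zero, mul_neg, neg_eq_zero, mul_eq_zero, hxy,
      or_false] at h₁ h₂
    simp [h₁, h₂]
  · rw [codisjoint_iff, eq_top_iff]
    intro z _
    obtain ⟨s, hs⟩ := hx z
    obtain ⟨t, ht⟩ := hy z
    have hyz : B y z = -(B x y * t) := by rw [← ht, hB.neg]
    refine Submodule.mem_sup.2 ⟨t • x + s • y, Submodule.mem_span_pair.2 ⟨t, s, rfl⟩,
      z - (t • x + s • y), ⟨?_, ?_⟩, by abel⟩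
    · simp [hB x, hs, mul_comm]
    · simp [hB y, hyz, hyx, mul_comm]

/-- Every alternating form on a free `ℤ`-module of finite even rank is an orthogonal sum of
alternating planes. -/
theorem exists_basis_toMatrix₂_eq_blockDiagonal (g : ℕ) :
    ∀ {V : Type} [AddCommGroup V] [Module.Free ℤ V] [Module.Finite ℤ V]
      (B : V →ₗ[ℤ] V →ₗ[ℤ] ℤ), B.IsAlt → Module.finrank ℤ V = 2 * g →
      ∃ (ι : Type) (_ : Fintype ι) (_ : DecidableEq ι) (b : Module.Basis (Fin 2 × ι) ℤ V)
        (d : ι → ℤ), LinearMap.toMatrix₂ b b B = blockDiagonal fun i => alternatingBlock (d i) := by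
  induction g with
  | zero =>
    intro V _ _ _ B _ hV
    have b := Module.finBasisOfFinrankEq ℤ V hV
    exact ⟨Fin 0, inferInstance, inferInstance, b.reindex finProdFinEquiv.symm, 0,
      Subsingleton.elim _ _⟩
  | succ g ih =>
    intro V _ _ _ B hB hV
    by_cases hB₀ : B = 0
    · refine ⟨Fin (g + 1), inferInstance, inferInstance,
        (Module.finBasisOfFinrankEq ℤ V hV).reindex finProdFinEquiv.symm, 0, ?_⟩
      ext ⟨a, i⟩ ⟨c, j⟩
      fin_cases a <;> fin_cases c <;>
        simp [hB₀, blockDiagonal_apply, alternatingBlock]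
    obtain ⟨x, y, hxy, hx, hy⟩ := exists_bilin_value_dvd B hB₀
    have hyx : B y x = -B x y := (hB.neg x y).symm
    have hc := isCompl_span_pair_orthogonal B hB hxy hx hy
    have hli : LinearIndependent ℤ ![x, y] := by
      rw [LinearIndependent.pair_iff]
      intro s t h
      have h₁ := congrArg (B x) h
      have h₂ := congrArg (B y) h
      simp only [map_add, map_smul, hB x, hB y, hyx, smul_eq_mul, mul_zero, zero_add, add_zero,
        mul_neg, map_zero, neg_eq_zero, mul_eq_zero, hxy, or_false] at h₁ h₂
      exact ⟨h₂, h₁⟩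
    set W := LinearMap.ker (B x) ⊓ LinearMap.ker (B y) with hW
    set bP := Module.Basis.span hli
    set E := Submodule.prodEquivOfIsCompl _ W hc
    have hrank : Module.finrank ℤ W = 2 * g := by
      have h := E.finrank_eq
      rw [Module.finrank_prod, Module.finrank_eq_card_basis bP, hV, Fintype.card_fin] at h
      omega
    obtain ⟨ι, _, _, b, d, hb⟩ := ih (B.domRestrict₁₂ W W) (fun z => hB z) hrank
    let e : Fin 2 ⊕ Fin 2 × ι ≃ Fin 2 × (Unit ⊕ ι) :=
      ((Equiv.prodPUnit (Fin 2)).symm.sumCongr (Equiv.refl _)).trans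
        (Equiv.prodSumDistrib _ _ _).symm
    let b' := ((bP.prod b).map E).reindex e
    have hl : ∀ a u, b' (a, Sum.inl u) = ![x, y] a := fun a u => by
      simp [b', e, E, bP, Module.Basis.span_apply]
    have hr : ∀ a i, b' (a, Sum.inr i) = b (a, i) := fun a i => by
      simp [b', e, E]
    have hlr : ∀ a (w : W), B (![x, y] a) w = 0 := fun a w => by
      have hw := w.2
      fin_cases a
      exacts [hw.1, hw.2]
    refine ⟨Unit ⊕ ι, inferInstance, inferInstance, b', Sum.elim (fun _ => B x y) d, ?_⟩
    ext ⟨a, i⟩ ⟨c, j⟩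
    rw [LinearMap.toMatrix₂_apply, blockDiagonal_apply]
    rcases i with i | i <;> rcases j with j | j
    · fin_cases a <;> fin_cases c <;> simp [hl, hB x, hB y, hyx, alternatingBlock]
    · simp [hl, hr, hlr]
    · rw [hl, hr, ← hB.neg, hlr]
      simp
    · have h := congrFun (congrFun hb (a, i)) (c, j)
      rw [LinearMap.toMatrix₂_apply, blockDiagonal_apply] at h
      simpa only [hr, Sum.elim_inr, Sum.inr.injEq, LinearMap.domRestrict₁₂_apply] using h

/-- Multiplying by a left invertible matrix on the left and a right invertible matrix on the
right preserves the cardinality of the image. -/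
theorem card_range_mulVecLin_mul_mul {R m n m' n' : Type*} [CommRing R] [Fintype m] [Fintype n]
    [Fintype m'] [Fintype n'] [DecidableEq m] [DecidableEq n] (P : Matrix m' m R)
    (A : Matrix m n R) (Q : Matrix n n' R) (P' : Matrix m m' R) (Q' : Matrix n' n R)
    (hP : P' * P = 1) (hQ : Q * Q' = 1) :
    Nat.card (LinearMap.range (P * A * Q).mulVecLin) = Nat.card (LinearMap.range A.mulVecLin) := by
  have hinj : Function.Injective P.mulVecLin :=
    Function.LeftInverse.injective (g := P'.mulVecLin) fun v => by simp [hP]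
  have hsurj : LinearMap.range Q.mulVecLin = ⊤ :=
    LinearMap.range_eq_top.2 <|
      Function.RightInverse.surjective (g := Q'.mulVecLin) fun v => by simp [hQ]
  rw [mulVecLin_mul, mulVecLin_mul, LinearMap.range_comp_of_range_eq_top _ hsurj,
    LinearMap.range_comp]
  exact (Nat.card_congr (Submodule.equivMapOfInjective _ hinj _).toEquiv).symm

/-- The ideal of `ZMod n` generated by `d` has `n / gcd d n` elements. -/
theorem ZMod.card_span_intCast_mul_gcd (n : ℕ) [NeZero n] (d : ℤ) :
    Nat.card (Ideal.span {(d : ZMod n)}) * Int.gcd d n = n := by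
  have hs : ((Ideal.span {(d : ZMod n)} : Ideal (ZMod n)) : Set (ZMod n)) =
      AddSubgroup.zmultiples ((d.natAbs : ℕ) : ZMod n) := by
    ext v
    rw [SetLike.mem_coe, SetLike.mem_coe, Ideal.mem_span_singleton',
      AddSubgroup.mem_zmultiples_iff]
    rcases Int.natAbs_eq d with h | h
    · rw [h]
      constructor
      · rintro ⟨a, rfl⟩
        exact ⟨a.val, by simp⟩
      · rintro ⟨k, rfl⟩
        exact ⟨k, by simp⟩
    · rw [h]
      constructor
      · rintro ⟨a, rfl⟩
        exact ⟨-a.val, by simp⟩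
      · rintro ⟨k, rfl⟩
        exact ⟨-k, by simp⟩
  have hcard : Nat.card (Ideal.span {(d : ZMod n)}) =
      Nat.card (AddSubgroup.zmultiples ((d.natAbs : ℕ) : ZMod n)) :=
    Nat.card_congr (Equiv.setCongr hs)
  rw [hcard, Nat.card_zmultiples, ZMod.addOrderOf_coe _ (NeZero.ne n), Nat.gcd_comm]
  exact Nat.div_mul_cancel (Nat.gcd_dvd_right _ _)

/-- The cardinality of the image of an orthogonal sum of alternating planes. -/
theorem card_range_blockDiagonal_alternatingBlock {R ι : Type*} [CommRing R] [Fintype ι]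
    [DecidableEq ι] (d : ι → R) :
    Nat.card (LinearMap.range (blockDiagonal fun i => alternatingBlock (d i)).mulVecLin) =
      ∏ i, Nat.card (Ideal.span {d i}) ^ 2 := by
  have hmul : ∀ v : Fin 2 × ι → R, ∀ i,
      ((blockDiagonal fun i => alternatingBlock (d i)) *ᵥ v) (0, i) = d i * v (1, i) ∧
      ((blockDiagonal fun i => alternatingBlock (d i)) *ᵥ v) (1, i) = -(d i * v (0, i)) := by
    intro v i
    simp [mulVec, dotProduct, Fintype.sum_prod_type, blockDiagonal_apply, alternatingBlock]
  have hs : (LinearMap.range (blockDiagonal fun i => alternatingBlock (d i)).mulVecLin :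
      Set (Fin 2 × ι → R)) = {v | ∀ p, v p ∈ Ideal.span {d p.2}} := by
    ext v
    simp only [SetLike.mem_coe, LinearMap.mem_range, mulVecLin_apply, Set.mem_ofPred_eq,
      Ideal.mem_span_singleton']
    constructor
    · rintro ⟨w, rfl⟩ ⟨a, i⟩
      fin_cases a
      · exact ⟨w (1, i), by simp [(hmul w i).1, mul_comm]⟩
      · exact ⟨-w (0, i), by simp [(hmul w i).2, mul_comm]⟩
    · intro h
      choose w hw using h
      refine ⟨fun p => if p.1 = 0 then -w (1, p.2) else w (0, p.2), ?_⟩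
      ext ⟨a, i⟩
      fin_cases a
      · simp [(hmul _ i).1, ← hw (0, i), mul_comm]
      · simp [(hmul _ i).2, ← hw (1, i), mul_comm]
  have hcard := Nat.card_congr ((Equiv.setCongr hs).trans
    (Equiv.subtypePiEquivPi (p := fun (p : Fin 2 × ι) v => v ∈ Ideal.span {d p.2})))
  refine hcard.trans ?_
  rw [Nat.card_pi, Fintype.prod_prod_type_right]
  simp [sq]

/-- Replacing the factors of a multiple of `n` by their gcds with `n` keeps it a multiple of `n`. -/
theorem dvd_mul_prod_gcd_of_dvd_mul_prod {ι : Type*} (s : Finset ι) (n x : ℕ) (d : ι → ℤ)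
    (h : (n : ℤ) ∣ x * ∏ i ∈ s, d i) : n ∣ x * ∏ i ∈ s, Int.gcd (d i) n := by
  classical
  induction s using Finset.induction_on generalizing x with
  | empty => simpa [Int.natCast_dvd_natCast] using h
  | insert i s hi ih =>
    rw [Finset.prod_insert hi, mul_left_comm, ← Int.dvd_gcd_mul_iff_dvd_mul, Int.gcd_comm] at h
    rw [Finset.prod_insert hi, ← mul_assoc]
    refine ih _ ?_
    rwa [Nat.cast_mul, mul_comm (x : ℤ), mul_assoc]

/-- If `M` is an alternating `2g × 2g` integer matrix with
`n² ∣ det(M)` (vanishing Pfaffian modulo `n`), then `|im(M mod n)|` divides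
`n^{2(g-1)}`. -/
theorem stmt_13 (g n : ℕ) (hg : 1 ≤ g) (hn : 1 ≤ n)
    (M : Matrix (Fin (2 * g)) (Fin (2 * g)) ℤ)
    (hskew : Mᵀ = -M)
    (hdet : (n : ℤ) ^ 2 ∣ M.det) :
    Nat.card (LinearMap.range ((M.map (Int.cast : ℤ → ZMod n)).mulVecLin)) ∣
      n ^ (2 * (g - 1)) := by
  have : NeZero n := ⟨by omega⟩
  obtain ⟨ι, _, _, b, d, hb⟩ := exists_basis_toMatrix₂_eq_blockDiagonal g
    (Matrix.toLinearMap₂' ℤ M) (fun v => by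
      rw [Matrix.toLinearMap₂'_apply']
      have h : v ⬝ᵥ M *ᵥ v = -(v ⬝ᵥ M *ᵥ v) := by
        conv_lhs => rw [dotProduct_mulVec, ← mulVec_transpose, hskew, dotProduct_comm]
        simp [neg_mulVec]
      omega) (by simp)
  let s := Pi.basisFun ℤ (Fin (2 * g))
  have hM : LinearMap.toMatrix₂ s s (Matrix.toLinearMap₂' ℤ M) = M := by
    rw [LinearMap.toMatrix₂_basisFun, LinearMap.toMatrix'_toLinearMap₂']
  have hbs : (s.toMatrix b)ᵀ * M * s.toMatrix b =
      blockDiagonal fun i => alternatingBlock (d i) := by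
    rw [← hb, ← LinearMap.toMatrix₂_mul_basis_toMatrix s s b b, hM]
  have hinv := s.toMatrix_mul_toMatrix_flip b
  have hι : Fintype.card ι = g := by
    have h := Fintype.card_congr (b.indexEquiv s)
    simp at h
    omega
  have hdet' : M.det = (∏ i, d i) ^ 2 := by
    let e := b.indexEquiv s
    have hunit : (s.toMatrix (b.reindex e)).det * (s.toMatrix (b.reindex e)).det = 1 :=
      Int.isUnit_mul_self (s.isUnit_det (b.reindex e))
    have hsub : LinearMap.toMatrix₂ (b.reindex e) (b.reindex e) (Matrix.toLinearMap₂' ℤ M) =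
        (LinearMap.toMatrix₂ b b (Matrix.toLinearMap₂' ℤ M)).submatrix e.symm e.symm := by
      ext i j
      simp only [LinearMap.toMatrix₂_apply, submatrix_apply, Module.Basis.reindex_apply]
    have h := congrArg det hsub
    rw [← LinearMap.toMatrix₂_mul_basis_toMatrix s s, hM, hb, det_submatrix_equiv_self, det_mul,
      det_mul, det_transpose, mul_right_comm, hunit, one_mul, det_blockDiagonal] at h
    simpa [alternatingBlock, det_fin_two, ← sq, Finset.prod_pow] using h
  have hdvd : n ∣ ∏ i, Int.gcd (d i) n := by
    rw [hdet', Int.pow_dvd_pow_iff two_ne_zero] at hdet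
    simpa using dvd_mul_prod_gcd_of_dvd_mul_prod Finset.univ n 1 d (by simpa using hdet)
  have hcard : Nat.card (LinearMap.range ((M.map (Int.cast : ℤ → ZMod n)).mulVecLin)) =
      (∏ i, Nat.card (Ideal.span {(d i : ZMod n)})) ^ 2 := by
    have hcast := congrArg (fun A => A.map (Int.castRingHom (ZMod n))) hbs
    simp only [Matrix.map_mul] at hcast
    have hblock : (blockDiagonal fun i => alternatingBlock (d i)).map (Int.castRingHom (ZMod n)) =
        blockDiagonal fun i => alternatingBlock (d i : ZMod n) := by
      rw [blockDiagonal_map _ _ (map_zero _)]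
      congr 1
      ext i a c
      fin_cases a <;> fin_cases c <;> simp [alternatingBlock]
    have hQ := congrArg (fun A => A.map (Int.castRingHom (ZMod n))) hinv
    have hP := congrArg (fun A => Aᵀ.map (Int.castRingHom (ZMod n))) hinv
    simp only [transpose_mul, Matrix.map_mul, transpose_one,
      Matrix.map_one _ (map_zero _) (map_one _)] at hQ hP
    rw [← Finset.prod_pow, ← card_range_blockDiagonal_alternatingBlock, ← hblock, ← hcast]
    exact (card_range_mulVecLin_mul_mul _ _ _ _ _ hP hQ).symm
  have hprod : (∏ i, Nat.card (Ideal.span {(d i : ZMod n)})) * ∏ i, Int.gcd (d i) n = n ^ g := by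
    rw [← Finset.prod_mul_distrib]
    simp [ZMod.card_span_intCast_mul_gcd, hι]
  rw [hcard, mul_comm 2, pow_mul]
  refine pow_dvd_pow_of_dvd ?_ 2
  obtain ⟨c, hc⟩ := hdvd
  refine ⟨c, Nat.eq_of_mul_eq_mul_right hn ?_⟩
  rw [← pow_succ, Nat.sub_add_cancel hg, ← hprod, hc]
  ring
end
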